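/- Let d ≥ 2 and n ≥ 2, let P be a d-polytope in ℝ^d with Minkowski measure of asymmetry σ = σ(P), and let 𝒫 = {xᵢ + τᵢP : xᵢ ∈ ℝ^d, τᵢ > 0, i = 1, …, n} be a weakly non-separable family of positive homothets of P. Then some translate of ((σ + 1)/2)·(Σᵢ₌₁ⁿ τᵢ)·P contains ⋃𝒫. -/

import Mathlib

open Set Metric Pointwise MeasureTheory

noncomputable section

abbrev Euc (d : ℕ) := EuclideanSpace ℝ (Fin d)

variable {d : ℕ}

/-- A convex body: compact, convex, with nonempty interior. -/
def IsConvexBody (K : Set (Euc d)) : Prop :=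
  IsCompact K ∧ Convex ℝ K ∧ (interior K).Nonempty

/-- A hyperplane of `ℝ^d`. -/
def IsHyperplane (H : Set (Euc d)) : Prop :=
  ∃ u : Euc d, u ≠ 0 ∧ ∃ c : ℝ, H = {x : Euc d | (inner ℝ x u : ℝ) = c}

/-- A straight line in `ℝ^d`. -/
def IsLine (L : Set (Euc d)) : Prop :=
  ∃ p v : Euc d, v ≠ 0 ∧ L = {x : Euc d | ∃ t : ℝ, x = p + t • v}

/-- A `d`-polytope: convex hull of finitely many points, with nonempty interior. -/
def IsPolytope (P : Set (Euc d)) : Prop :=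
  ∃ S : Finset (Euc d), P = convexHull ℝ (S : Set (Euc d)) ∧ (interior P).Nonempty

/-- A `d`-simplex: convex hull of `d+1` affinely independent points. -/
def IsSimplex (d : ℕ) (T : Set (Euc d)) : Prop :=
  ∃ v : Fin (d + 1) → Euc d, AffineIndependent ℝ v ∧ T = convexHull ℝ (Set.range v)

/-- The exposed face of `P` in direction `u`. -/
def exposedFaceAt (P : Set (Euc d)) (u : Euc d) : Set (Euc d) :=
  {x ∈ P | ∀ y ∈ P, (inner ℝ y u : ℝ) ≤ (inner ℝ x u : ℝ)}

/-- `u` is the outer unit normal vector of a facet of `P`. -/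
def IsFacetNormal (P : Set (Euc d)) (u : Euc d) : Prop :=
  ‖u‖ = 1 ∧ Module.finrank ℝ (affineSpan ℝ (exposedFaceAt P u)).direction = d - 1

/-- The hyperplane `H` is parallel to some facet of `P`:
some translate of `H` contains the facet. -/
def HypParallelToFacet (P H : Set (Euc d)) : Prop :=
  ∃ u : Euc d, IsFacetNormal P u ∧ ∃ v : Euc d, exposedFaceAt P u ⊆ (fun x => v + x) '' H

/-- The positive homothet `x + τ • P`. -/
def homo (x : Euc d) (τ : ℝ) (P : Set (Euc d)) : Set (Euc d) := {x} + τ • P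

/-- A weakly non-separable family of positive homothets of the polytope `P`. -/
def WNS (P : Set (Euc d)) {n : ℕ} (x : Fin n → Euc d) (τ : Fin n → ℝ) : Prop :=
  ∀ H : Set (Euc d), IsHyperplane H → HypParallelToFacet P H →
    (H ∩ convexHull ℝ (⋃ i, homo (x i) (τ i) P)).Nonempty →
    ∃ i, (H ∩ homo (x i) (τ i) P).Nonempty

/-- A non-separable family of convex bodies. -/
def NS {n : ℕ} (F : Fin n → Set (Euc d)) : Prop :=
  ∀ H : Set (Euc d), IsHyperplane H →
    (H ∩ convexHull ℝ (⋃ i, F i)).Nonempty → ∃ i, (H ∩ F i).Nonempty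

/-- `A` is a `k`-dimensional affine subspace of `ℝ^d` (as a set). -/
def IsAffSub (k : ℕ) (A : Set (Euc d)) : Prop :=
  ∃ S : AffineSubspace ℝ (Euc d), (S : Set (Euc d)) = A ∧ A.Nonempty ∧
    Module.finrank ℝ S.direction = k

/-- The affine subspace `A` is parallel to some facet of `P`:
some translate of `A` is contained in the affine hull of the facet. -/
def SubParallelToFacet (P A : Set (Euc d)) : Prop :=
  ∃ u : Euc d, IsFacetNormal P u ∧ ∃ v : Euc d,
    (fun x => v + x) '' A ⊆ (affineSpan ℝ (exposedFaceAt P u) : Set (Euc d))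

/-- A weakly `k`-impassable family of positive homothets of the polytope `P`. -/
def WIP (k : ℕ) (P : Set (Euc d)) {n : ℕ} (x : Fin n → Euc d) (τ : Fin n → ℝ) : Prop :=
  ∀ A : Set (Euc d), IsAffSub k A → SubParallelToFacet P A →
    (A ∩ convexHull ℝ (⋃ i, homo (x i) (τ i) P)).Nonempty →
    ∃ i, (A ∩ homo (x i) (τ i) P).Nonempty

/-- A full-rank lattice in `ℝ^d`. -/
def IsFullLattice (L : Set (Euc d)) : Prop :=
  ∃ b : Module.Basis (Fin d) ℝ (Euc d),
    L = Set.range fun z : Fin d → ℤ => ∑ i, (z i : ℝ) • b i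

/-- The integer lattice `ℤ^d` as a subset of `ℝ^d`. -/
def intLattice (d : ℕ) : Set (Euc d) := {x : Euc d | ∀ i, ∃ z : ℤ, x i = (z : ℝ)}

/-- The unit cube `[0,1]^d`. -/
def unitCube (d : ℕ) : Set (Euc d) := {x : Euc d | ∀ i, x i ∈ Set.Icc (0 : ℝ) 1}

/-- The axis-parallel hyperplane `{x : x_j = c}`. -/
def axisHyp (d : ℕ) (j : Fin d) (c : ℝ) : Set (Euc d) := {x : Euc d | x j = c}

/-- A weakly non-separable family of translates of the unit cube. -/
def CubeWNS {d n : ℕ} (p : Fin n → Euc d) : Prop :=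
  ∀ (j : Fin d) (c : ℝ),
    (axisHyp d j c ∩ convexHull ℝ (⋃ k, {p k} + unitCube d)).Nonempty →
    ∃ k, (axisHyp d j c ∩ ({p k} + unitCube d)).Nonempty


/-- The Minkowski measure of asymmetry of a convex body. -/
def minkAsym (K : Set (Euc d)) : ℝ :=
  sInf {μ : ℝ | 0 < μ ∧ ∃ q ∈ interior K,
    ∀ x ∈ K, ∃ y ∈ K, x - q = -μ • (y - q)}

/-- If the intervals `[b i - ℓ i, b i]` cover everything between `b k` and `b j`, then those that
end after `b k` have total length at least `b j - b k`. -/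
lemma sub_le_sum_length {ι : Type*} [Fintype ι] (b ℓ : ι → ℝ) (hℓ : ∀ i, 0 ≤ ℓ i) (j k : ι)
    (hcov : ∀ t, b k < t → t ≤ b j → ∃ i, b i - ℓ i ≤ t ∧ t ≤ b i) :
    b j - b k ≤ ∑ i, if b k < b i then ℓ i else 0 := by
  classical
  have hnonneg : 0 ≤ ∑ i, (if b k < b i then ℓ i else 0) :=
    Finset.sum_nonneg fun i _ => by split_ifs <;> simp [hℓ]
  have hsub : Ioc (b k) (b j) ⊆
      ⋃ i ∈ Finset.univ.filter (fun i => b k < b i), Icc (b i - ℓ i) (b i) := by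
    intro t ht
    obtain ⟨i, hi⟩ := hcov t ht.1 ht.2
    simp only [Finset.mem_filter, Finset.mem_univ, true_and, mem_iUnion]
    exact ⟨i, ht.1.trans_le hi.2, hi⟩
  have hvol := (measure_mono (μ := volume) hsub).trans (measure_biUnion_finset_le _ _)
  simp only [Real.volume_Ioc, Real.volume_Icc, sub_sub_cancel] at hvol
  rw [← ENNReal.ofReal_sum_of_nonneg (fun i _ => hℓ i), Finset.sum_filter] at hvol
  exact (ENNReal.ofReal_le_ofReal_iff hnonneg).1 hvol

/-- A weighted estimate for the right end of a connected union of intervals `[b i - ℓ i, b i]`. -/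
lemma sum_length_mul_sub_le {ι : Type*} [Fintype ι] (b ℓ : ι → ℝ) (hℓ : ∀ i, 0 ≤ ℓ i) (j : ι)
    (hcov : ∀ k t, b k < t → t ≤ b j → ∃ i, b i - ℓ i ≤ t ∧ t ≤ b i) :
    2 * ∑ k, ℓ k * (b j - b k) ≤ (∑ i, ℓ i) ^ 2 - ∑ i, ℓ i ^ 2 := by
  classical
  have hle : ∑ k, ℓ k * (b j - b k) ≤ ∑ k, ∑ i, (if b k < b i then ℓ k * ℓ i else 0) := by
    refine Finset.sum_le_sum fun k _ => ?_
    refine (mul_le_mul_of_nonneg_left (sub_le_sum_length b ℓ hℓ j k (hcov k)) (hℓ k)).trans_eq ?_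
    simp [Finset.mul_sum]
  have hswap : ∑ k, ∑ i, (if b k < b i then ℓ k * ℓ i else 0)
      = ∑ k, ∑ i, (if b i < b k then ℓ k * ℓ i else 0) := by
    rw [Finset.sum_comm]
    simp only [mul_comm]
  have hdiag : ∑ i, ℓ i ^ 2 = ∑ k, ∑ i, (if k = i then ℓ k * ℓ i else 0) := by
    simp [sq]
  have htotal : ∑ k, ∑ i, (if b k < b i then ℓ k * ℓ i else 0)
      + ∑ k, ∑ i, (if b i < b k then ℓ k * ℓ i else 0)
      + ∑ k, ∑ i, (if k = i then ℓ k * ℓ i else 0) ≤ (∑ i, ℓ i) ^ 2 := by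
    rw [sq, Finset.sum_mul_sum, ← Finset.sum_add_distrib, ← Finset.sum_add_distrib]
    refine Finset.sum_le_sum fun k _ => ?_
    rw [← Finset.sum_add_distrib, ← Finset.sum_add_distrib]
    refine Finset.sum_le_sum fun i _ => ?_
    have := mul_nonneg (hℓ k) (hℓ i)
    rcases lt_trichotomy (b k) (b i) with h | h | h
    · have : k ≠ i := by rintro rfl; exact h.false
      simp [h, h.not_gt, this]
    · rw [h]
      split_ifs <;> simp_all
    · have : k ≠ i := by rintro rfl; exact h.false
      simp [h, h.not_gt, this]
  linarith

lemma IsPolytope.isCompact {P : Set (Euc d)} (hP : IsPolytope P) : IsCompact P := by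
  obtain ⟨S, rfl, -⟩ := hP
  exact S.finite_toSet.isCompact_convexHull ℝ

lemma IsPolytope.convex {P : Set (Euc d)} (hP : IsPolytope P) : Convex ℝ P := by
  obtain ⟨S, rfl, -⟩ := hP
  exact convex_convexHull ℝ _

lemma IsPolytope.nonempty {P : Set (Euc d)} (hP : IsPolytope P) : P.Nonempty := by
  obtain ⟨S, -, h⟩ := hP
  exact h.mono interior_subset

/-- The polar of `S` with respect to the centre `p`. -/
def polarAt (S : Set (Euc d)) (p : Euc d) : Set (Euc d) :=
  {u | ∀ s ∈ S, (inner ℝ (s - p) u : ℝ) ≤ 1}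

lemma inner_sub_le_of_mem_convexHull {S : Set (Euc d)} {p u y : Euc d} (hu : u ∈ polarAt S p)
    (hy : y ∈ convexHull ℝ S) : (inner ℝ (y - p) u : ℝ) ≤ 1 := by
  have hconv : Convex ℝ {y : Euc d | (inner ℝ (y - p) u : ℝ) ≤ 1} := by
    intro a ha b hb s t hs ht hst
    simp only [mem_ofPred_eq] at *
    have : s • a + t • b - p = s • (a - p) + t • (b - p) := by
      obtain rfl : s = 1 - t := by linarith
      module
    rw [this, inner_add_left, real_inner_smul_left, real_inner_smul_left]
    nlinarith
  exact convexHull_min (fun s hs => hu s hs) hconv hy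

lemma isClosed_polarAt (S : Set (Euc d)) (p : Euc d) : IsClosed (polarAt S p) := by
  simp only [polarAt, ofPred_forall]
  exact isClosed_iInter fun s => isClosed_iInter fun _ =>
    isClosed_le (by fun_prop) continuous_const

lemma isCompact_polarAt {S : Set (Euc d)} {p : Euc d} (hp : p ∈ interior (convexHull ℝ S)) :
    IsCompact (polarAt S p) := by
  obtain ⟨r, hr, hball⟩ := Metric.mem_nhds_iff.1 (mem_interior_iff_mem_nhds.1 hp)
  refine (isCompact_closedBall (0 : Euc d) (2 / r)).of_isClosed_subset (isClosed_polarAt S p) ?_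
  intro u hu
  rw [mem_closedBall_zero_iff]
  rcases eq_or_ne u 0 with rfl | hu0
  · simp only [norm_zero]; positivity
  have hnorm : 0 < ‖u‖ := norm_pos_iff.2 hu0
  have hmem : p + (r / 2 / ‖u‖) • u ∈ convexHull ℝ S := by
    apply hball
    rw [Metric.mem_ball, dist_self_add_left, norm_smul, Real.norm_of_nonneg (by positivity),
      div_mul_cancel₀ _ hnorm.ne']
    linarith
  have h := inner_sub_le_of_mem_convexHull hu hmem
  rw [add_sub_cancel_left, real_inner_smul_left, real_inner_self_eq_norm_sq] at h
  have : r / 2 / ‖u‖ * ‖u‖ ^ 2 = r / 2 * ‖u‖ := by field_simp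
  rw [this] at h
  rw [le_div_iff₀ hr]
  linarith

/-- The points of `S` whose constraints are active at an extreme point of the polar span. -/
lemma span_active_eq_top {S : Set (Euc d)} (hS : S.Finite) {p u : Euc d}
    (hu : u ∈ (polarAt S p).extremePoints ℝ) :
    Submodule.span ℝ {w | ∃ s ∈ S, w = s - p ∧ (inner ℝ w u : ℝ) = 1} = ⊤ := by
  set A : Set (Euc d) := {w | ∃ s ∈ S, w = s - p ∧ (inner ℝ w u : ℝ) = 1} with hA
  by_contra hne
  have hbot : (Submodule.span ℝ A)ᗮ ≠ ⊥ := fun h => hne (Submodule.orthogonal_eq_bot_iff.1 h)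
  obtain ⟨v, hv, hv0⟩ := Submodule.exists_mem_ne_zero_of_ne_bot hbot
  have hvA : ∀ w ∈ A, (inner ℝ w v : ℝ) = 0 := fun w hw =>
    (Submodule.mem_orthogonal _ _).1 hv w (Submodule.subset_span hw)
  have hup := extremePoints_subset hu
  have hev : ∀ s ∈ S, ∀ᶠ ε in nhdsWithin (0 : ℝ) (Ioi 0),
      (inner ℝ (s - p) (u + ε • v) : ℝ) ≤ 1 ∧ (inner ℝ (s - p) (u - ε • v) : ℝ) ≤ 1 := by
    intro s hs
    rcases (hup s hs).lt_or_eq with hlt | heq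
    · have hadd : Continuous fun ε : ℝ => (inner ℝ (s - p) (u + ε • v) : ℝ) := by fun_prop
      have hsub : Continuous fun ε : ℝ => (inner ℝ (s - p) (u - ε • v) : ℝ) := by fun_prop
      have e₁ := hadd.continuousAt.eventually_lt (x₀ := 0) continuousAt_const (by simpa using hlt)
      have e₂ := hsub.continuousAt.eventually_lt (x₀ := 0) continuousAt_const (by simpa using hlt)
      exact nhdsWithin_le_nhds ((e₁.and e₂).mono fun ε h => ⟨h.1.le, h.2.le⟩)
    · have := hvA (s - p) ⟨s, hs, rfl, heq⟩
      exact Filter.Eventually.of_forall fun ε => by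
        simp [inner_add_right, inner_sub_right, inner_smul_right, this, heq]
  obtain ⟨ε, hε, hpos⟩ := (((hS.eventually_all).2 hev).and self_mem_nhdsWithin).exists
  have hpos : 0 < ε := hpos
  have hseg : u ∈ openSegment ℝ (u + ε • v) (u - ε • v) :=
    ⟨1 / 2, 1 / 2, by norm_num, by norm_num, by norm_num, by module⟩
  have := (mem_extremePoints.1 hu).2 _ (fun s hs => (hε s hs).1) _ (fun s hs => (hε s hs).2) hseg
  have h0 : ε • v = 0 := by simpa using this.1
  exact (smul_ne_zero hpos.ne' hv0) h0

lemma inner_eq_of_mem_exposedFaceAt {P : Set (Euc d)} {u x y : Euc d}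
    (hx : x ∈ exposedFaceAt P u) (hy : y ∈ exposedFaceAt P u) :
    (inner ℝ x u : ℝ) = inner ℝ y u :=
  le_antisymm (hy.2 x hx.1) (hx.2 y hy.1)

/-- An exposed face is a facet as soon as its translate by `-p` spans the space. -/
lemma finrank_direction_exposedFaceAt {P : Set (Euc d)} {u p : Euc d} (hd : 1 ≤ d) (hu : u ≠ 0)
    (hspan : Submodule.span ℝ ((fun x => x - p) '' exposedFaceAt P u) = ⊤) :
    Module.finrank ℝ (affineSpan ℝ (exposedFaceAt P u)).direction = d - 1 := by
  set F := exposedFaceAt P u with hF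
  rw [direction_affineSpan]
  have hdim : Module.finrank ℝ (Euc d) = d := by simp
  obtain ⟨a, ha⟩ : F.Nonempty := by
    by_contra h
    rw [not_nonempty_iff_eq_empty.1 h, image_empty, Submodule.span_empty] at hspan
    exact hu ((Submodule.mem_bot ℝ).1 (hspan ▸ Submodule.mem_top))
  have hlt : Module.finrank ℝ (vectorSpan ℝ F) < d := by
    refine (Submodule.finrank_lt fun htop => hu ?_).trans_eq hdim
    have hle : vectorSpan ℝ F ≤ (Submodule.span ℝ {u})ᗮ := by
      rw [vectorSpan_def, Submodule.span_le]
      rintro _ ⟨x, hx, y, hy, rfl⟩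
      rw [SetLike.mem_coe, Submodule.mem_orthogonal_singleton_iff_inner_left]
      simp [inner_sub_left, inner_eq_of_mem_exposedFaceAt hx hy]
    have := hle (htop ▸ Submodule.mem_top : u ∈ vectorSpan ℝ F)
    rw [Submodule.mem_orthogonal_singleton_iff_inner_left] at this
    exact inner_self_eq_zero.1 this
  have hle : (⊤ : Submodule ℝ (Euc d)) ≤ Submodule.span ℝ {a - p} ⊔ vectorSpan ℝ F := by
    rw [← hspan, Submodule.span_le]
    rintro _ ⟨x, hx, rfl⟩
    have hsum : x - p = (a - p) + (x - a) := by abel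
    change x - p ∈ _
    rw [hsum]
    exact Submodule.add_mem_sup (Submodule.mem_span_singleton_self _)
      (vsub_mem_vectorSpan ℝ hx ha)
  have h₁ := Submodule.finrank_mono hle
  have h₂ := Submodule.finrank_add_le_finrank_add_finrank
    (Submodule.span ℝ {a - p}) (vectorSpan ℝ F)
  have h₃ : Module.finrank ℝ (Submodule.span ℝ {a - p}) ≤ 1 :=
    (finrank_span_le_card {a - p}).trans_eq (by simp)
  rw [finrank_top, hdim] at h₁
  omega

lemma exposedFaceAt_smul (P : Set (Euc d)) (u : Euc d) {r : ℝ} (hr : 0 < r) :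
    exposedFaceAt P (r • u) = exposedFaceAt P u := by
  ext x
  simp [exposedFaceAt, real_inner_smul_right, hr]

/-- A point outside a polytope is strictly separated from it by a facet hyperplane. -/
lemma IsPolytope.exists_isFacetNormal_lt (hd : 1 ≤ d) {P : Set (Euc d)} (hP : IsPolytope P)
    {z : Euc d} (hz : z ∉ P) :
    ∃ u, IsFacetNormal P u ∧ ∀ y ∈ P, (inner ℝ y u : ℝ) < inner ℝ z u := by
  have hclosed := hP.isCompact.isClosed
  have hconvex := hP.convex
  obtain ⟨S, rfl, p, hp⟩ := hP
  have hpP := interior_subset hp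
  set C := polarAt (S : Set (Euc d)) p with hC
  obtain ⟨w, hwC, hw⟩ : ∃ w ∈ C, 1 < (inner ℝ (z - p) w : ℝ) := by
    obtain ⟨f, t, hft, htz⟩ := geometric_hahn_banach_closed_point hconvex hclosed hz
    obtain ⟨g, rfl⟩ := (InnerProductSpace.toDual ℝ (Euc d)).surjective f
    simp only [InnerProductSpace.toDual_apply_apply] at hft htz
    have hpos : 0 < t - inner ℝ g p := sub_pos.2 (hft p hpP)
    refine ⟨(t - inner ℝ g p)⁻¹ • g, fun s hs => ?_, ?_⟩
    · rw [real_inner_smul_right, real_inner_comm g, inner_sub_right, inv_mul_le_iff₀ hpos]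
      linarith [hft s (subset_convexHull ℝ _ hs)]
    · rw [real_inner_smul_right, real_inner_comm g, inner_sub_right, lt_inv_mul_iff₀ hpos]
      linarith
  set l : StrongDual ℝ (Euc d) := InnerProductSpace.toDual ℝ (Euc d) (z - p) with hl
  have hexp : IsExposed ℝ C (l.toExposed C) := ContinuousLinearMap.toExposed.isExposed
  have hCc : IsCompact C := isCompact_polarAt hp
  obtain ⟨m, hmC, hmax⟩ := hCc.exists_isMaxOn ⟨w, hwC⟩ l.continuous.continuousOn
  obtain ⟨u, hu⟩ := (hexp.isCompact hCc).extremePoints_nonempty ⟨m, hmC, fun y hy => hmax hy⟩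
  have huC : u ∈ C.extremePoints ℝ := hexp.isExtreme.extremePoints_subset_extremePoints hu
  have huz : 1 < (inner ℝ (z - p) u : ℝ) :=
    hw.trans_le ((extremePoints_subset hu).2 w hwC)
  have hu0 : u ≠ 0 := by
    rintro rfl
    simp at huz
    linarith
  have hle : ∀ y ∈ convexHull ℝ (S : Set (Euc d)), (inner ℝ (y - p) u : ℝ) ≤ 1 := fun y hy =>
    inner_sub_le_of_mem_convexHull (extremePoints_subset huC) hy
  have hspan : Submodule.span ℝ
      ((fun x => x - p) '' exposedFaceAt (convexHull ℝ (S : Set (Euc d))) u) = ⊤ := by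
    rw [← top_le_iff, ← span_active_eq_top S.finite_toSet huC]
    refine Submodule.span_mono ?_
    rintro _ ⟨s, hs, rfl, h1⟩
    refine ⟨s, ⟨subset_convexHull ℝ _ hs, fun y hy => ?_⟩, rfl⟩
    have := hle y hy
    rw [inner_sub_left] at this h1
    linarith
  have hnorm : 0 < ‖u‖⁻¹ := inv_pos.2 (norm_pos_iff.2 hu0)
  refine ⟨‖u‖⁻¹ • u, ⟨norm_smul_inv_norm hu0, ?_⟩, fun y hy => ?_⟩
  · rw [exposedFaceAt_smul _ _ hnorm]
    exact finrank_direction_exposedFaceAt hd hu0 hspan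
  · have := hle y hy
    rw [inner_sub_left] at this huz
    rw [real_inner_smul_right, real_inner_smul_right]
    exact mul_lt_mul_of_pos_left (by linarith) hnorm

/-- The ratios over which `minkAsym` is an infimum. -/
def asymRatios (K : Set (Euc d)) : Set ℝ :=
  {μ : ℝ | 0 < μ ∧ ∃ q ∈ interior K, ∀ x ∈ K, ∃ y ∈ K, x - q = -μ • (y - q)}

lemma asymRatios_nonempty {K : Set (Euc d)} (hK : Bornology.IsBounded K)
    (hint : (interior K).Nonempty) : (asymRatios K).Nonempty := by
  obtain ⟨q, hq⟩ := hint
  obtain ⟨r, hr, hball⟩ := Metric.mem_nhds_iff.1 (mem_interior_iff_mem_nhds.1 hq)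
  obtain ⟨R, hR, hKR⟩ := hK.subset_closedBall_lt 0 q
  have hμ : 0 < 2 * R / r := by positivity
  refine ⟨2 * R / r, hμ, q, hq, fun x hx => ⟨q - (2 * R / r)⁻¹ • (x - q), hball ?_, ?_⟩⟩
  · have hxR := hKR hx
    rw [Metric.mem_closedBall, dist_eq_norm] at hxR
    rw [Metric.mem_ball, dist_self_sub_left, norm_smul, Real.norm_of_nonneg (by positivity),
      inv_mul_lt_iff₀ hμ, div_mul_cancel₀ _ hr.ne']
    linarith
  · rw [sub_sub_cancel_left, smul_neg, neg_smul, neg_neg, smul_inv_smul₀ hμ.ne']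

lemma one_le_of_mem_asymRatios {K : Set (Euc d)} (hK : Bornology.IsBounded K)
    (hdiam : 0 < Metric.diam K) {μ : ℝ} (hμ : μ ∈ asymRatios K) : 1 ≤ μ := by
  obtain ⟨hpos, q, -, hq⟩ := hμ
  have hle : Metric.diam K ≤ μ * Metric.diam K := by
    refine Metric.diam_le_of_forall_dist_le (by positivity) fun x hx x' hx' => ?_
    obtain ⟨y, hy, hxy⟩ := hq x hx
    obtain ⟨y', hy', hxy'⟩ := hq x' hx'
    have : x - x' = -μ • (y - y') := by
      rw [← sub_sub_sub_cancel_right x x' q, hxy, hxy']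
      module
    rw [dist_eq_norm, this, norm_smul, norm_neg, Real.norm_of_nonneg hpos.le, ← dist_eq_norm]
    exact mul_le_mul_of_nonneg_left (Metric.dist_le_diam_of_mem hK hy hy') hpos.le
  exact (le_mul_iff_one_le_left hdiam).1 hle

lemma diam_pos_of_interior_nonempty (hd : 1 ≤ d) {K : Set (Euc d)} (hK : Bornology.IsBounded K)
    (hint : (interior K).Nonempty) : 0 < Metric.diam K := by
  obtain ⟨m, rfl⟩ : ∃ m, d = m + 1 := ⟨d - 1, by omega⟩
  obtain ⟨q, hq⟩ := hint
  refine Metric.diam_pos ?_ hK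
  by_contra hsub
  rw [not_nontrivial_iff] at hsub
  have hsingle : K = {q} := hsub.eq_singleton_of_mem (interior_subset hq)
  rw [hsingle, interior_singleton] at hq
  exact hq

/-- The Minkowski measure of asymmetry of a compact body is attained, and is at least `1`. -/
lemma exists_minkAsym_center (hd : 1 ≤ d) {K : Set (Euc d)} (hK : IsCompact K)
    (hint : (interior K).Nonempty) :
    1 ≤ minkAsym K ∧ ∃ q ∈ K, ∀ x ∈ K, q - (minkAsym K)⁻¹ • (x - q) ∈ K := by
  have hdiam := diam_pos_of_interior_nonempty hd hK.isBounded hint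
  have hne := asymRatios_nonempty hK.isBounded hint
  have hone : ∀ μ ∈ asymRatios K, 1 ≤ μ := fun μ hμ =>
    one_le_of_mem_asymRatios hK.isBounded hdiam hμ
  have hσ : 1 ≤ minkAsym K := le_csInf hne hone
  refine ⟨hσ, ?_⟩
  obtain ⟨μ, -, hμlim, hμ⟩ := exists_seq_tendsto_sInf hne ⟨1, hone⟩
  change Filter.Tendsto μ Filter.atTop (nhds (minkAsym K)) at hμlim
  choose hpos c hcint hc using hμ
  obtain ⟨q, hqK, φ, hφ, hlim⟩ := hK.tendsto_subseq fun k => interior_subset (hcint k)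
  refine ⟨q, hqK, fun x hx => ?_⟩
  have hmem : ∀ k, c (φ k) - (μ (φ k))⁻¹ • (x - c (φ k)) ∈ K := by
    intro k
    obtain ⟨y, hy, hxy⟩ := hc (φ k) x hx
    rw [hxy, neg_smul, smul_neg, inv_smul_smul₀ (hpos _).ne', sub_neg_eq_add, add_sub_cancel]
    exact hy
  refine hK.isClosed.mem_of_tendsto (b := Filter.atTop) ?_ (Filter.Eventually.of_forall hmem)
  have hinv := (hμlim.comp hφ.tendsto_atTop).inv₀ (by linarith)
  exact hlim.sub (hinv.smul (tendsto_const_nhds.sub hlim))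

/-- A set with nonempty interior has positive width in every nonzero direction. -/
lemma exists_inner_lt_of_interior_nonempty {K : Set (Euc d)} (hint : (interior K).Nonempty)
    {u : Euc d} (hu : u ≠ 0) : ∃ y ∈ K, ∃ y' ∈ K, (inner ℝ y u : ℝ) < inner ℝ y' u := by
  obtain ⟨q, hq⟩ := hint
  have hcont : Continuous fun ε : ℝ => q + ε • u := by fun_prop
  have hev : ∀ᶠ ε in nhdsWithin (0 : ℝ) (Ioi 0), q + ε • u ∈ interior K :=
    nhdsWithin_le_nhds (hcont.continuousAt.eventually_mem (isOpen_interior.mem_nhds (by simpa)))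
  obtain ⟨ε, hε, hpos⟩ := (hev.and self_mem_nhdsWithin).exists
  refine ⟨q, interior_subset hq, q + ε • u, interior_subset hε, ?_⟩
  rw [inner_add_left, real_inner_smul_left]
  exact lt_add_of_pos_right _ (mul_pos hpos (real_inner_self_pos.2 hu))

lemma mem_homo_iff {P : Set (Euc d)} {x y : Euc d} {τ : ℝ} :
    y ∈ homo x τ P ↔ ∃ p ∈ P, y = x + τ • p := by
  simp only [homo, singleton_add, mem_image, mem_smul_set]
  constructor
  · rintro ⟨_, ⟨p, hp, rfl⟩, rfl⟩
    exact ⟨p, hp, rfl⟩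
  · rintro ⟨p, hp, rfl⟩
    exact ⟨_, ⟨p, hp, rfl⟩, rfl⟩

/-- The level sets of a facet normal are hyperplanes parallel to the facet. -/
lemma hypParallelToFacet_setOf_inner_eq {P : Set (Euc d)} {u : Euc d} (hu : IsFacetNormal P u)
    {a : Euc d} (ha : a ∈ exposedFaceAt P u) (t : ℝ) :
    HypParallelToFacet P {y : Euc d | (inner ℝ y u : ℝ) = t} := by
  refine ⟨u, hu, ((inner ℝ a u : ℝ) - t) • u, fun y hy => ⟨y - ((inner ℝ a u : ℝ) - t) • u, ?_, ?_⟩⟩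
  · rw [mem_ofPred_eq, inner_sub_left, real_inner_smul_left, real_inner_self_eq_norm_sq, hu.1,
      inner_eq_of_mem_exposedFaceAt hy ha]
    ring
  · simp

/-- A weakly non-separable family meets every facet-parallel level set lying between the support
levels of two of its members. -/
lemma WNS.exists_inner_eq {P : Set (Euc d)} {n : ℕ} {x : Fin n → Euc d} {τ : Fin n → ℝ}
    (hWNS : WNS P x τ) {u a : Euc d} (hu : IsFacetNormal P u) (ha : a ∈ exposedFaceAt P u)
    {j k : Fin n} {t : ℝ} (hk : (inner ℝ (x k + τ k • a) u : ℝ) ≤ t)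
    (hj : t ≤ (inner ℝ (x j + τ j • a) u : ℝ)) :
    ∃ i, ∃ p ∈ P, (inner ℝ (x i + τ i • p) u : ℝ) = t := by
  have hu0 : u ≠ 0 := norm_ne_zero_iff.1 (by rw [hu.1]; exact one_ne_zero)
  have hmem : ∀ i, x i + τ i • a ∈ convexHull ℝ (⋃ i, homo (x i) (τ i) P) := fun i =>
    subset_convexHull ℝ _ (mem_iUnion.2 ⟨i, mem_homo_iff.2 ⟨a, ha.1, rfl⟩⟩)
  have hpre : IsPreconnected (convexHull ℝ (⋃ i, homo (x i) (τ i) P)) :=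
    (convex_convexHull ℝ _).isPreconnected
  have hcont : ContinuousOn (fun y : Euc d => (inner ℝ y u : ℝ))
      (convexHull ℝ (⋃ i, homo (x i) (τ i) P)) := by fun_prop
  obtain ⟨y, hy, hyt⟩ := hpre.intermediate_value (hmem k) (hmem j) hcont ⟨hk, hj⟩
  obtain ⟨i, z, hz, hzi⟩ := hWNS {y : Euc d | (inner ℝ y u : ℝ) = t} ⟨u, hu0, t, rfl⟩
    (hypParallelToFacet_setOf_inner_eq hu ha t) ⟨y, hyt, hy⟩
  obtain ⟨p, hp, rfl⟩ := mem_homo_iff.1 hzi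
  exact ⟨i, p, hp, hz⟩

/-- The estimate in a facet direction `u` of the support level of a member of a weakly
non-separable family; `a` and `b` maximize and minimize `⟨·, u⟩` on `P`. -/
lemma WNS.sum_mul_inner_le {P : Set (Euc d)} {n : ℕ} {x : Fin n → Euc d} {τ : Fin n → ℝ}
    (hτ : ∀ i, 0 < τ i) (hWNS : WNS P x τ) {u a b : Euc d} (hu : IsFacetNormal P u)
    (ha : a ∈ exposedFaceAt P u) (hb : ∀ y ∈ P, (inner ℝ b u : ℝ) ≤ inner ℝ y u)
    (hab : (inner ℝ b u : ℝ) < inner ℝ a u) (j : Fin n) :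
    2 * ∑ k, τ k * ((inner ℝ (x j + τ j • a) u : ℝ) - inner ℝ (x k + τ k • a) u) ≤
      ((inner ℝ a u : ℝ) - inner ℝ b u) * ((∑ i, τ i) ^ 2 - ∑ i, τ i ^ 2) := by
  set w : ℝ := (inner ℝ a u : ℝ) - inner ℝ b u with hw
  have hwpos : 0 < w := sub_pos.2 hab
  have h := sum_length_mul_sub_le (fun i => (inner ℝ (x i + τ i • a) u : ℝ)) (fun i => w * τ i)
    (fun i => mul_nonneg hwpos.le (hτ i).le) j (fun k t hk hj => by
      obtain ⟨i, p, hp, rfl⟩ := hWNS.exists_inner_eq hu ha hk.le hj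
      have h₁ := mul_le_mul_of_nonneg_left (ha.2 p hp) (hτ i).le
      have h₂ := mul_le_mul_of_nonneg_left (hb p hp) (hτ i).le
      refine ⟨i, ?_, ?_⟩ <;> simp only [inner_add_left, real_inner_smul_left, hw] <;> linarith)
  simp only [mul_assoc, mul_pow, ← Finset.mul_sum] at h
  refine le_of_mul_le_mul_left ?_ hwpos
  linarith

/-- a translate of `((σ(P)+1)/2)(∑τᵢ)P` covers any WNS-family of
positive homothets of a d-polytope `P`. -/
theorem stmt_10 (d n : ℕ) (hd : 2 ≤ d) (hn : 2 ≤ n)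
    (P : Set (Euc d)) (hP : IsPolytope P)
    (x : Fin n → Euc d) (τ : Fin n → ℝ) (hτ : ∀ i, 0 < τ i)
    (hWNS : WNS P x τ) :
    ∃ c : Euc d, (⋃ i, homo (x i) (τ i) P) ⊆
      homo c ((minkAsym P + 1) / 2 * ∑ i, τ i) P := by
  have hd1 : 1 ≤ d := by omega
  have hPc := hP.isCompact
  have hint : (interior P).Nonempty := hP.choose_spec.2
  obtain ⟨hσ, q, hqP, hq⟩ := exists_minkAsym_center hd1 hPc hint
  set σ := minkAsym P with hσdef
  have hn0 : (Finset.univ : Finset (Fin n)).Nonempty := ⟨⟨0, by omega⟩, Finset.mem_univ _⟩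
  set T := ∑ i, τ i with hT
  have hTpos : 0 < T := Finset.sum_pos (fun i _ => hτ i) hn0
  set Q := ∑ i, τ i ^ 2 with hQ
  have hQT : Q ≤ T ^ 2 := Finset.sum_sq_le_sq_sum_of_nonneg fun i _ => (hτ i).le
  have hlam : 0 < (σ + 1) / 2 * T := by positivity
  set lam := (σ + 1) / 2 * T with hlamdef
  set c : Euc d := T⁻¹ • (∑ i, τ i • x i + (Q - T * lam) • q) with hc
  refine ⟨c, iUnion_subset fun j z hz => ?_⟩
  obtain ⟨p, hp, rfl⟩ := mem_homo_iff.1 hz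
  rw [mem_homo_iff]
  refine ⟨lam⁻¹ • (x j + τ j • p - c), ?_, by rw [smul_inv_smul₀ hlam.ne', add_sub_cancel]⟩
  by_contra hout
  obtain ⟨u, hu, hsep⟩ := hP.exists_isFacetNormal_lt hd1 hout
  have hcont : ContinuousOn (fun y : Euc d => (inner ℝ y u : ℝ)) P := by fun_prop
  obtain ⟨a, haP, hamax⟩ := hPc.exists_isMaxOn hP.nonempty hcont
  obtain ⟨b, hbP, hbmin⟩ := hPc.exists_isMinOn hP.nonempty hcont
  have ha : a ∈ exposedFaceAt P u := ⟨haP, fun y hy => hamax hy⟩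
  have hb : ∀ y ∈ P, (inner ℝ b u : ℝ) ≤ inner ℝ y u := fun y hy => hbmin hy
  have hqb : (inner ℝ q u : ℝ) - inner ℝ b u ≤ σ * (inner ℝ a u - inner ℝ q u) := by
    have h := ha.2 _ (hq b hbP)
    rw [inner_sub_left, real_inner_smul_left, inner_sub_left] at h
    have h' : σ⁻¹ * ((inner ℝ q u : ℝ) - inner ℝ b u) ≤ inner ℝ a u - inner ℝ q u := by linarith
    rwa [inv_mul_le_iff₀ (by linarith)] at h'
  have hqa := ha.2 q hqP
  have hcu : T * (inner ℝ c u : ℝ) =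
      ∑ i, τ i * (inner ℝ (x i) u : ℝ) + (Q - T * lam) * inner ℝ q u := by
    rw [hc, real_inner_smul_left, mul_inv_cancel_left₀ hTpos.ne', inner_add_left, sum_inner]
    simp only [real_inner_smul_left]
  have hsepa := hsep a haP
  rw [real_inner_smul_left, lt_inv_mul_iff₀ hlam, inner_sub_left] at hsepa
  have hpj : (inner ℝ (x j + τ j • p) u : ℝ) ≤ inner ℝ (x j + τ j • a) u := by
    simp only [inner_add_left, real_inner_smul_left]
    linarith [mul_le_mul_of_nonneg_left (ha.2 p hp) (hτ j).le]
  have hab : (inner ℝ b u : ℝ) < inner ℝ a u := by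
    have hu0 : u ≠ 0 := norm_ne_zero_iff.1 (by rw [hu.1]; exact one_ne_zero)
    obtain ⟨y, hy, y', hy', hlt⟩ := exists_inner_lt_of_interior_nonempty hint hu0
    exact (hb y hy).trans_lt (hlt.trans_le (ha.2 y' hy'))
  have hmain := hWNS.sum_mul_inner_le hτ hu ha hb hab j
  have hsum : ∑ k, τ k * ((inner ℝ (x j + τ j • a) u : ℝ) - inner ℝ (x k + τ k • a) u) =
      T * (inner ℝ (x j + τ j • a) u : ℝ) - ∑ k, τ k * (inner ℝ (x k) u : ℝ)
        - Q * (inner ℝ a u : ℝ) := by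
    rw [hT, hQ, Finset.sum_mul, Finset.sum_mul, ← Finset.sum_sub_distrib,
      ← Finset.sum_sub_distrib]
    refine Finset.sum_congr rfl fun k _ => ?_
    rw [inner_add_left (x k), real_inner_smul_left]
    ring
  rw [hsum] at hmain
  have hT_sep := mul_lt_mul_of_pos_left (hsepa.trans_le (sub_le_sub_right hpj _)) hTpos
  rw [mul_sub, hcu] at hT_sep
  have hwidth := mul_le_mul_of_nonneg_left hqb (sub_nonneg.2 hQT)
  have hQ0 : 0 ≤ Q := Finset.sum_nonneg fun i _ => sq_nonneg _
  have hheight := mul_nonneg hQ0 (mul_nonneg (sub_nonneg.2 hσ) (sub_nonneg.2 hqa))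
  rw [hlamdef] at hT_sep
  nlinarith

end
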